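/- Let I ⊆ k[x_0, ..., x_{n-2}] be a homogeneous ideal (with n ≥ 4) such that for some integer i, the degree-i piece I^{(i)} contains every monomial of degree i in the variables x_0, ..., x_{n-3} (i.e., all monomials not involving x_{n-2}). Then dim_k I^{(i+1)} - dim_k I^{(i)} ≥ C(i + n - 2, n - 3). -/

import Mathlib

/-- The degree-`l` graded piece of an ideal of `k[x_0, ..., x_{n-2}]`
(polynomial ring in `n-1` variables), as a `k`-subspace. -/
noncomputable def gradedPiece (k : Type) [Field k] (n : ℕ)
    (I : Ideal (MvPolynomial (Fin (n - 1)) k)) (l : ℕ) :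
    Submodule k (MvPolynomial (Fin (n - 1)) k) :=
  I.restrictScalars k ⊓ MvPolynomial.homogeneousSubmodule (Fin (n - 1)) k l

/-- If a homogeneous ideal `I ⊆ k[x_0, …, x_{n-2}]` (with `n ≥ 4`) contains every
monomial of degree `i` in the variables `x_0, …, x_{n-3}` (those not involving the
last variable `x_{n-2}`), then `dim I^{(i+1)} - dim I^{(i)} ≥ C(i + n - 2, n - 3)`. -/
theorem stmt_11 (k : Type) [Field k] (n : ℕ) (hn : 4 ≤ n)
    (I : Ideal (MvPolynomial (Fin (n - 1)) k))
    (hhom : ∀ p ∈ I, ∀ d : ℕ, MvPolynomial.homogeneousComponent d p ∈ I)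
    (i : ℕ)
    (hmon : ∀ m : Fin (n - 1) →₀ ℕ,
      (∑ j, m j) = i → m ⟨n - 2, by omega⟩ = 0 →
        MvPolynomial.monomial m (1 : k) ∈ I) :
    Module.finrank k (gradedPiece k n I i) + Nat.choose (i + n - 2) (n - 3) ≤
      Module.finrank k (gradedPiece k n I (i + 1)) := by
  classical
  set a : Fin (n - 1) := ⟨n - 2, by omega⟩ with ha
  set S : Finset (Fin (n - 1) →₀ ℕ) :=
    (Finset.univ.erase a).finsuppAntidiag (i + 1) with hS
  have hSmem : ∀ m ∈ S, (∑ j, m j) = i + 1 ∧ m a = 0 := by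
    intro m hm
    rw [hS, Finset.mem_finsuppAntidiag] at hm
    have h0 : m a = 0 := by
      by_contra h
      have := hm.2 (Finsupp.mem_support_iff.mpr h)
      simp at this
    refine ⟨?_, h0⟩
    rw [← Finset.add_sum_erase _ _ (Finset.mem_univ a), h0, hm.1, zero_add]
  have hScard : S.card = Nat.choose (i + n - 2) (n - 3) := by
    rw [hS, Finset.card_finsuppAntidiag_nat_eq_choose, Finset.card_erase_of_mem (Finset.mem_univ a),
      Finset.card_univ, Fintype.card_fin]
    have h1 : n - 1 - 1 + (i + 1) - 1 = i + n - 2 := by omega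
    rw [h1]
    exact Nat.choose_symm_of_eq_add (by omega)
  let B : Submodule k (MvPolynomial (Fin (n - 1)) k) :=
    MvPolynomial.restrictSupport k (S : Set (Fin (n - 1) →₀ ℕ))
  let f : MvPolynomial (Fin (n - 1)) k →ₗ[k] MvPolynomial (Fin (n - 1)) k :=
    LinearMap.mulLeft k (MvPolynomial.X a)
  have hf : Function.Injective f := by
    intro p q h
    exact MvPolynomial.X_mul_cancel_left_iff.mp h
  let A := (gradedPiece k n I i).map f
  have hBfin : Module.finrank k B = S.card := by
    rw [Module.finrank_eq_card_basis (MvPolynomial.basisRestrictSupport k _)]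
    simp
  have hAfin : Module.finrank k A = Module.finrank k (gradedPiece k n I i) :=
    (LinearEquiv.finrank_eq (Submodule.equivMapOfInjective f hf _)).symm
  have hfd : ∀ l, Module.Finite k (gradedPiece k n I l) := by
    intro l
    have : Module.Finite k (MvPolynomial.homogeneousSubmodule (Fin (n - 1)) k l) :=
      Module.Finite.iff_fg.mpr (MvPolynomial.homogeneousSubmodule_fg _ _ _)
    exact Submodule.finiteDimensional_of_le (inf_le_right)
  have : Module.Finite k B :=
    Module.Finite.of_basis (MvPolynomial.basisRestrictSupport k _)
  have : Module.Finite k A := by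
    infer_instance
  have hdisj : A ⊓ B = ⊥ := by
    rw [eq_bot_iff]
    rintro _ ⟨⟨p, -, rfl⟩, hB⟩
    rw [Submodule.mem_bot]
    ext m
    by_contra hne
    have hmS : m ∈ S := hB (MvPolynomial.mem_support_iff.mpr hne)
    apply hne
    have : f p = MvPolynomial.X a * p := rfl
    rw [this, MvPolynomial.coeff_X_mul']
    simp [(hSmem m hmS).2]
  have hA : A ≤ gradedPiece k n I (i + 1) := by
    rintro _ ⟨p, ⟨hpI, hpd⟩, rfl⟩
    refine ⟨I.mul_mem_left _ hpI, ?_⟩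
    have := (MvPolynomial.isHomogeneous_X k a).mul
      ((MvPolynomial.mem_homogeneousSubmodule _ _).mp hpd)
    rw [add_comm] at this
    exact this
  have hBle : B ≤ gradedPiece k n I (i + 1) := by
    change MvPolynomial.restrictSupport k _ ≤ _
    rw [MvPolynomial.restrictSupport_eq_span, Submodule.span_le]
    rintro _ ⟨m, hm, rfl⟩
    obtain ⟨hm1, hm2⟩ := hSmem m hm
    refine ⟨?_, ?_⟩
    · obtain ⟨j, hj⟩ : ∃ j, m j ≠ 0 := by
        by_contra! h
        simp [h] at hm1
      have hle : Finsupp.single j 1 ≤ m := by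
        rw [Finsupp.single_le_iff]; omega
      obtain ⟨m', rfl⟩ := exists_add_of_le hle
      have hmem : MvPolynomial.monomial m' (1 : k) ∈ I := by
        apply hmon
        · simp only [Finsupp.add_apply, Finset.sum_add_distrib] at hm1
          have : ∑ x, (Finsupp.single j 1 : Fin (n - 1) →₀ ℕ) x = 1 := by
            simp [Finsupp.single_apply]
          omega
        · simp only [Finsupp.add_apply] at hm2
          change m' a = 0
          omega
      have := I.mul_mem_left (MvPolynomial.monomial (Finsupp.single j 1) (1 : k)) hmem
      rw [MvPolynomial.monomial_mul, one_mul] at this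
      exact this
    · apply MvPolynomial.isHomogeneous_monomial
      rw [Finsupp.degree_eq_sum]
      exact hm1
  have h1 := Submodule.finrank_sup_add_finrank_inf_eq A B
  rw [hdisj, finrank_bot, add_zero, hAfin, hBfin, hScard] at h1
  rw [← h1]
  exact Submodule.finrank_mono (sup_le hA hBle)
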